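/- arXiv:1604.00113 — 2 statements merged into one kernel-verified Lean document; each statement's English description precedes it below -/
import Mathlib

section
/- Bottleneck stability of max-plus polynomials on barcode space: let 𝒟 be the smallest set of functions from barcodes to ℝ containing all constant functions and the functions σ_{(0,1)^n} for every n ≥ 1, and closed under pointwise addition and pointwise maximum. Then for every F ∈ 𝒟 there exists a constant C ≥ 0 such that |F(B_1) − F(B_2)| ≤ C · d_∞(B_1, B_2) for every pair of barcodes B_1 and B_2. -/
/-- Distance between two intervals given as (left endpoint, length):
`d_∞((x₁,d₁),(x₂,d₂)) = max(|x₁ − x₂|, |d₁ − d₂ + x₁ − x₂|)`. -/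
def intervalDist (I J : ℝ × ℝ) : ℝ := max |I.1 - J.1| |I.2 - J.2 + I.1 - J.1|

/-- A partial matching between two barcodes (finite multisets of intervals), encoded
as a multiset of matched pairs: the first components form a submultiset of `B₁`, the
second components a submultiset of `B₂`. -/
def IsMatching (B₁ B₂ : Multiset (ℝ × ℝ)) (M : Multiset ((ℝ × ℝ) × (ℝ × ℝ))) : Prop :=
  M.map Prod.fst ≤ B₁ ∧ M.map Prod.snd ≤ B₂

/-- The bottleneck penalty `P_∞(θ)` of a partial matching: the maximum of the interval
distances of matched pairs and of `d/2` over all unmatched intervals `(x, d)`. -/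
noncomputable def penaltyInf (B₁ B₂ : Multiset (ℝ × ℝ))
    (M : Multiset ((ℝ × ℝ) × (ℝ × ℝ))) : ℝ :=
  ((M.map fun IJ : (ℝ × ℝ) × (ℝ × ℝ) => intervalDist IJ.1 IJ.2) +
      (((B₁ - M.map Prod.fst) + (B₂ - M.map Prod.snd)).map
        fun I : ℝ × ℝ => I.2 / 2)).fold max 0

/-- The bottleneck distance between two barcodes. -/
noncomputable def bottleneckDist (B₁ B₂ : Multiset (ℝ × ℝ)) : ℝ :=
  sInf { r | ∃ M, IsMatching B₁ B₂ M ∧ r = penaltyInf B₁ B₂ M }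

/-- The `q`-th Wasserstein penalty `P_q(θ)` of a partial matching. -/
noncomputable def penaltyP (q : ℝ) (B₁ B₂ : Multiset (ℝ × ℝ))
    (M : Multiset ((ℝ × ℝ) × (ℝ × ℝ))) : ℝ :=
  (M.map fun IJ : (ℝ × ℝ) × (ℝ × ℝ) => intervalDist IJ.1 IJ.2 ^ q).sum +
    ((((B₁ - M.map Prod.fst) + (B₂ - M.map Prod.snd)).map
      fun I : ℝ × ℝ => (I.2 / 2) ^ q)).sum

/-- The `q`-th Wasserstein distance between two barcodes. -/
noncomputable def wassersteinDist (q : ℝ) (B₁ B₂ : Multiset (ℝ × ℝ)) : ℝ :=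
  (sInf { r | ∃ M, IsMatching B₁ B₂ M ∧ r = penaltyP q B₁ B₂ M }) ^ (1 / q)

/-- `sigmaN n B` = `σ_{(0,1)ⁿ}(B)`: the sum of the `n` largest lengths of intervals
of `B` (for barcodes, i.e. multisets of pairs of nonnegative reals, the supremum below
is exactly the sum of the `n` largest lengths, counting missing intervals as 0). -/
noncomputable def sigmaN (n : ℕ) (B : Multiset (ℝ × ℝ)) : ℝ :=
  sSup { r | ∃ s : Multiset ℝ, s ≤ B.map Prod.snd ∧ s.card ≤ n ∧ r = s.sum }

/-- A barcode: a finite multiset of intervals `(x, d) ∈ [0,∞) × [0,∞)`. -/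
def Barcode : Type := { B : Multiset (ℝ × ℝ) // ∀ I ∈ B, 0 ≤ I.1 ∧ 0 ≤ I.2 }

/-- The smallest set of functions from barcodes to `ℝ` containing all constant
functions and the functions `σ_{(0,1)ⁿ}` for every `n ≥ 1`, and closed under pointwise
addition and pointwise maximum. -/
inductive MemD : (Barcode → ℝ) → Prop
  | const (c : ℝ) : MemD (fun _ => c)
  | sigma (n : ℕ) (hn : 1 ≤ n) : MemD (fun B => sigmaN n B.1)
  | add {f g} : MemD f → MemD g → MemD (fun B => f B + g B)
  | max {f g} : MemD f → MemD g → MemD (fun B => max (f B) (g B))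

theorem Multiset.exists_le_map_eq_of_le_map {α β : Type*} {f : α → β} {s : Multiset β}
    {t : Multiset α} (h : s ≤ t.map f) : ∃ u ≤ t, u.map f = s := by
  induction s using Quotient.inductionOn with | _ l₁ =>
  induction t using Quotient.inductionOn with | _ l₂ =>
  obtain ⟨l, hl, hsub⟩ := h
  obtain ⟨l', hl', rfl⟩ := List.sublist_map_iff.mp hsub
  exact ⟨l', hl'.subperm, Multiset.coe_eq_coe.mpr hl⟩

theorem Multiset.fold_max_le_iff {α : Type*} [LinearOrder α] {s : Multiset α} {b r : α} :
    s.fold max b ≤ r ↔ b ≤ r ∧ ∀ a ∈ s, a ≤ r := by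
  induction s using Multiset.induction_on with
  | empty => simp
  | cons a s ih => simp [ih]; tauto

theorem penaltyInf_nonneg (B₁ B₂ : Multiset (ℝ × ℝ)) (M : Multiset ((ℝ × ℝ) × (ℝ × ℝ))) :
    0 ≤ penaltyInf B₁ B₂ M :=
  (Multiset.fold_max_le_iff.mp le_rfl).1

theorem bottleneckDist_nonneg (B₁ B₂ : Multiset (ℝ × ℝ)) : 0 ≤ bottleneckDist B₁ B₂ := by
  refine Real.sInf_nonneg ?_
  rintro _ ⟨M, -, rfl⟩
  exact penaltyInf_nonneg B₁ B₂ M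

theorem intervalDist_comm (I J : ℝ × ℝ) : intervalDist I J = intervalDist J I := by
  unfold intervalDist
  rw [abs_sub_comm I.1, ← abs_neg (I.2 - J.2 + I.1 - J.1)]
  ring_nf

theorem length_le_add_two_mul_intervalDist (I J : ℝ × ℝ) :
    I.2 ≤ J.2 + 2 * intervalDist I J := by
  have h₁ := (abs_le.mp (le_max_left |I.1 - J.1| |I.2 - J.2 + I.1 - J.1|)).1
  have h₂ := (abs_le.mp (le_max_right |I.1 - J.1| |I.2 - J.2 + I.1 - J.1|)).2
  unfold intervalDist
  linarith

theorem penaltyInf_swap (B₁ B₂ : Multiset (ℝ × ℝ)) (M : Multiset ((ℝ × ℝ) × (ℝ × ℝ))) :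
    penaltyInf B₂ B₁ (M.map Prod.swap) = penaltyInf B₁ B₂ M := by
  simp [penaltyInf, Multiset.map_map, add_comm, intervalDist_comm]

theorem IsMatching.swap {B₁ B₂ : Multiset (ℝ × ℝ)} {M : Multiset ((ℝ × ℝ) × (ℝ × ℝ))}
    (h : IsMatching B₁ B₂ M) : IsMatching B₂ B₁ (M.map Prod.swap) := by
  simpa [IsMatching, Multiset.map_map, Function.comp_def] using And.symm h

theorem Multiset.sum_map_le_sum_map_add_card_mul {α : Type*} {s : Multiset α} {f g : α → ℝ}
    {c : ℝ} (h : ∀ a ∈ s, f a ≤ g a + c) :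
    (s.map f).sum ≤ (s.map g).sum + s.card * c := by
  simpa using Multiset.sum_map_le_sum_map f (fun a => g a + c) h

theorem bddAbove_sums (n : ℕ) (B : Multiset (ℝ × ℝ)) :
    BddAbove { r | ∃ s : Multiset ℝ, s ≤ B.map Prod.snd ∧ s.card ≤ n ∧ r = s.sum } := by
  refine ((B.map Prod.snd).powerset.toFinset.image Multiset.sum).finite_toSet.subset ?_
    |>.bddAbove
  rintro _ ⟨s, hs, -, rfl⟩
  simpa using ⟨s, hs, rfl⟩

theorem sum_le_sigmaN {n : ℕ} {B t : Multiset (ℝ × ℝ)} (ht : t ≤ B) (hn : t.card ≤ n) :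
    (t.map Prod.snd).sum ≤ sigmaN n B :=
  le_csSup (bddAbove_sums n B) ⟨_, Multiset.map_le_map ht, by simpa using hn, rfl⟩

theorem sigmaN_le_add_mul_penaltyInf (n : ℕ) {B₁ B₂ : Multiset (ℝ × ℝ)}
    {M : Multiset ((ℝ × ℝ) × (ℝ × ℝ))} (hM : IsMatching B₁ B₂ M) :
    sigmaN n B₁ ≤ sigmaN n B₂ + 2 * n * penaltyInf B₁ B₂ M := by
  have hr := penaltyInf_nonneg B₁ B₂ M
  have hbound := (Multiset.fold_max_le_iff.mp (le_refl (penaltyInf B₁ B₂ M))).2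
  set r := penaltyInf B₁ B₂ M
  refine csSup_le ⟨0, 0, by simp⟩ ?_
  rintro _ ⟨s, hs, hsn, rfl⟩
  obtain ⟨t, ht, rfl⟩ := Multiset.exists_le_map_eq_of_le_map hs
  obtain ⟨N, hN, hNt⟩ := Multiset.exists_le_map_eq_of_le_map
    (Multiset.inter_le_right : t ∩ M.map Prod.fst ≤ M.map Prod.fst)
  have hsplit : t = N.map Prod.fst + (t - M.map Prod.fst) := by
    rw [hNt, add_comm, Multiset.sub_add_inter]
  have hcard : N.card + (t - M.map Prod.fst).card = t.card := by
    conv_rhs => rw [hsplit]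
    simp
  rw [Multiset.card_map] at hsn
  have hmatched : (N.map fun p => p.1.2).sum ≤ (N.map fun p => p.2.2).sum + N.card * (2 * r) := by
    refine Multiset.sum_map_le_sum_map_add_card_mul fun p hp => ?_
    have h := hbound (intervalDist p.1 p.2) (Multiset.mem_add.mpr
      (.inl (Multiset.mem_map_of_mem _ (Multiset.mem_of_le hN hp))))
    linarith [length_le_add_two_mul_intervalDist p.1 p.2]
  have hunmatched : ((t - M.map Prod.fst).map Prod.snd).sum ≤
      (t - M.map Prod.fst).card * (2 * r) := by
    have h := Multiset.sum_map_le_sum_map_add_card_mul (s := t - M.map Prod.fst)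
      (f := Prod.snd) (g := fun _ => 0) (c := 2 * r) fun I hI => ?_
    · simpa using h
    have h := hbound (I.2 / 2) (Multiset.mem_add.mpr (.inr (Multiset.mem_map.mpr
      ⟨I, Multiset.mem_add.mpr (.inl (Multiset.mem_of_le (tsub_le_tsub_right ht _) hI)), rfl⟩)))
    linarith
  have hsigma : (N.map fun p => p.2.2).sum ≤ sigmaN n B₂ := by
    have h := sum_le_sigmaN (n := n) (t := N.map Prod.snd)
      ((Multiset.map_le_map hN).trans hM.2) (by rw [Multiset.card_map]; omega)
    simpa [Multiset.map_map, Function.comp_def] using h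
  have htotal : (t.map Prod.snd).sum =
      (N.map fun p => p.1.2).sum + ((t - M.map Prod.fst).map Prod.snd).sum := by
    conv_lhs => rw [hsplit]
    simp [Multiset.map_map]
  have hle : ((N.card : ℝ) + (t - M.map Prod.fst).card) * (2 * r) ≤ n * (2 * r) := by
    gcongr
    exact_mod_cast hcard.trans_le hsn
  linarith

theorem abs_sigmaN_sub_le (n : ℕ) (B₁ B₂ : Multiset (ℝ × ℝ)) :
    |sigmaN n B₁ - sigmaN n B₂| ≤ 2 * n * bottleneckDist B₁ B₂ := by
  have hne : {r | ∃ M, IsMatching B₁ B₂ M ∧ r = penaltyInf B₁ B₂ M}.Nonempty :=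
    ⟨_, 0, by simp [IsMatching], rfl⟩
  rw [bottleneckDist, ← smul_eq_mul (2 * (n : ℝ)), ← Real.sInf_smul_of_nonneg (by positivity)]
  refine le_csInf hne.smul_set ?_
  rintro _ ⟨_, ⟨M, hM, rfl⟩, rfl⟩
  have h₁ := sigmaN_le_add_mul_penaltyInf n hM
  have h₂ := sigmaN_le_add_mul_penaltyInf n hM.swap
  rw [penaltyInf_swap] at h₂
  simp only [smul_eq_mul, abs_sub_le_iff]
  constructor <;> linarith

/-- Bottleneck stability of max-plus polynomials on the barcode space. -/
theorem maxplus_bottleneck_stability (F : Barcode → ℝ) (hF : MemD F) :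
    ∃ C : ℝ, 0 ≤ C ∧ ∀ B₁ B₂ : Barcode,
      |F B₁ - F B₂| ≤ C * bottleneckDist B₁.1 B₂.1 := by
  induction hF with
  | const c => exact ⟨0, le_rfl, by simp⟩
  | sigma n _ => exact ⟨2 * n, by positivity, fun B₁ B₂ => abs_sigmaN_sub_le n B₁.1 B₂.1⟩
  | @add f g _ _ hf hg =>
    obtain ⟨C, hC, hf⟩ := hf
    obtain ⟨D, hD, hg⟩ := hg
    refine ⟨C + D, by positivity, fun B₁ B₂ => ?_⟩
    rw [add_sub_add_comm, add_mul]
    exact (abs_add_le _ _).trans (add_le_add (hf B₁ B₂) (hg B₁ B₂))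
  | @max f g _ _ hf hg =>
    obtain ⟨C, hC, hf⟩ := hf
    obtain ⟨D, hD, hg⟩ := hg
    refine ⟨max C D, le_max_of_le_left hC, fun B₁ B₂ => ?_⟩
    have hd := bottleneckDist_nonneg B₁.1 B₂.1
    refine (abs_max_sub_max_le_max _ _ _ _).trans (max_le ((hf B₁ B₂).trans ?_)
      ((hg B₁ B₂).trans ?_))
    · gcongr
      exact le_max_left C D
    · gcongr
      exact le_max_right C D
end

section
/- Wasserstein stability of the semiring generated by the tropical rational coordinates: let 𝒢 be the smallest set of functions from barcodes to ℝ containing all constant functions and the functions E_{m,k,l,p} for all positive integers m and all nonnegative integers k, l, p with k + l + p ≥ 1, and closed under pointwise addition, pointwise maximum and pointwise minimum. Then for every F ∈ 𝒢 and every real q ≥ 1 there exists a constant C ≥ 0 such that |F(B_1) − F(B_2)| ≤ C · d_q(B_1, B_2) for every pair of barcodes B_1 and B_2. -/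
/-- The tropical rational coordinate `E_{m,k,l,p}` on barcodes: pad the barcode `B`
with zero intervals `(0,0)` so that it has at least `k + l + p` intervals, and take the
maximum, over all choices of `p + k + l` pairwise distinct intervals
`(x_1, d_1), …, (x_{p+k+l}, d_{p+k+l})` of the padded barcode, of
`Σ_{i=1}^{p} (min(x_i, m·d_i) + d_i) + Σ_{i=p+1}^{p+k} min(x_i, m·d_i)
  + Σ_{i=p+k+1}^{p+k+l} d_i`. -/
noncomputable def Efun (m k l p : ℕ) (B : Multiset (ℝ × ℝ)) : ℝ :=
  sSup { r | ∃ S₁ S₂ S₃ : Multiset (ℝ × ℝ),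
    S₁.card = p ∧ S₂.card = k ∧ S₃.card = l ∧
    S₁ + S₂ + S₃ ≤ B + Multiset.replicate (p + k + l) ((0 : ℝ), (0 : ℝ)) ∧
    r = (S₁.map fun I : ℝ × ℝ => min I.1 ((m : ℝ) * I.2) + I.2).sum +
        (S₂.map fun I : ℝ × ℝ => min I.1 ((m : ℝ) * I.2)).sum +
        (S₃.map fun I : ℝ × ℝ => I.2).sum }

/-- The smallest set of functions from barcodes to `ℝ` containing all constant
functions and the functions `E_{m,k,l,p}` for all positive integers `m` and all
nonnegative integers `k, l, p` with `k + l + p ≥ 1`, and closed under pointwise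
addition, pointwise maximum and pointwise minimum. -/
inductive MemG : (Barcode → ℝ) → Prop
  | const (c : ℝ) : MemG (fun _ => c)
  | coord (m k l p : ℕ) (hm : 1 ≤ m) (hklp : 1 ≤ k + l + p) :
      MemG (fun B => Efun m k l p B.1)
  | add {f g} : MemG f → MemG g → MemG (fun B => f B + g B)
  | max {f g} : MemG f → MemG g → MemG (fun B => max (f B) (g B))
  | min {f g} : MemG f → MemG g → MemG (fun B => min (f B) (g B))

/-- Two intervals are `ε`-close if the functions `min(x, m·d)` and `d` take close values
on them. -/
def IntervalsClose (m : ℕ) (ε : ℝ) (I J : ℝ × ℝ) : Prop :=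
  |min I.1 ((m : ℝ) * I.2) - min J.1 ((m : ℝ) * J.2)| ≤ 2 * m * ε ∧ |I.2 - J.2| ≤ 2 * ε

theorem IntervalsClose.symm {m : ℕ} {ε : ℝ} {I J : ℝ × ℝ} (h : IntervalsClose m ε I J) :
    IntervalsClose m ε J I := by
  unfold IntervalsClose at *
  rwa [abs_sub_comm (min J.1 _), abs_sub_comm J.2]

theorem IntervalsClose.of_intervalDist_le {m : ℕ} (hm : 1 ≤ m) {ε : ℝ} {I J : ℝ × ℝ}
    (h : intervalDist I J ≤ ε) : IntervalsClose m ε I J := by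
  obtain ⟨h₁, h₂⟩ := max_le_iff.1 h
  have hm' : (1 : ℝ) ≤ m := by exact_mod_cast hm
  have hε : 0 ≤ ε := (abs_nonneg _).trans h₁
  have hd : |I.2 - J.2| ≤ 2 * ε := by
    rw [abs_le] at *
    constructor <;> linarith
  refine ⟨(abs_min_sub_min_le_max _ _ _ _).trans (max_le ?_ ?_), hd⟩
  · nlinarith
  · rw [← mul_sub, abs_mul, abs_of_nonneg (by linarith : (0 : ℝ) ≤ m)]
    nlinarith

theorem IntervalsClose.zero_right {m : ℕ} {ε : ℝ} {I : ℝ × ℝ}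
    (h₁ : 0 ≤ I.1) (h₂ : 0 ≤ I.2) (h : I.2 / 2 ≤ ε) : IntervalsClose m ε I (0, 0) := by
  have hm : (0 : ℝ) ≤ m := m.cast_nonneg
  have h0 : 0 ≤ min I.1 ((m : ℝ) * I.2) := le_min h₁ (mul_nonneg hm h₂)
  have h3 := min_le_right I.1 ((m : ℝ) * I.2)
  refine ⟨?_, ?_⟩
  · simp only [mul_zero, min_self, sub_zero, abs_of_nonneg h0]
    nlinarith
  · simp only [sub_zero, abs_of_nonneg h₂]
    linarith

theorem Multiset.Rel.abs_sum_map_sub_le {α β : Type*} {r : α → β → Prop} {f : α → ℝ} {g : β → ℝ}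
    {c : ℝ} {s : Multiset α} {t : Multiset β} (h : Multiset.Rel r s t)
    (hr : ∀ a b, r a b → |f a - g b| ≤ c) :
    |(s.map f).sum - (t.map g).sum| ≤ s.card * c := by
  induction h with
  | zero => simp
  | @cons a b as bs hab _ ih =>
    have := hr a b hab
    simp only [Multiset.map_cons, Multiset.sum_cons, Multiset.card_cons, Nat.cast_add, Nat.cast_one]
    rw [abs_le] at *
    constructor <;> linarith

theorem Multiset.le_add_replicate_card {α : Type*} {s t : Multiset α} {a : α} {b : ℕ}
    (h : s ≤ t + Multiset.replicate b a) : s ≤ t + Multiset.replicate s.card a := by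
  classical
  rw [Multiset.le_iff_count] at *
  intro x
  have := h x
  simp only [Multiset.count_add, Multiset.count_replicate] at *
  have := Multiset.count_le_card x s
  split_ifs at * <;> omega

/-- The values over which `Efun` takes the supremum. -/
def efunValues (m k l p : ℕ) (B : Multiset (ℝ × ℝ)) : Set ℝ :=
  { r | ∃ S₁ S₂ S₃ : Multiset (ℝ × ℝ),
    S₁.card = p ∧ S₂.card = k ∧ S₃.card = l ∧
    S₁ + S₂ + S₃ ≤ B + Multiset.replicate (p + k + l) ((0 : ℝ), (0 : ℝ)) ∧
    r = (S₁.map fun I : ℝ × ℝ => min I.1 ((m : ℝ) * I.2) + I.2).sum +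
        (S₂.map fun I : ℝ × ℝ => min I.1 ((m : ℝ) * I.2)).sum +
        (S₃.map fun I : ℝ × ℝ => I.2).sum }

theorem efunValues_bddAbove (m k l p : ℕ) (B : Multiset (ℝ × ℝ)) :
    BddAbove (efunValues m k l p B) := by
  classical
  let X := B + Multiset.replicate (p + k + l) ((0 : ℝ), (0 : ℝ))
  have hX : (Set.Iic X).Finite := Set.finite_Iic X
  refine (((hX.prod (hX.prod hX)).image
    fun S : Multiset (ℝ × ℝ) × Multiset (ℝ × ℝ) × Multiset (ℝ × ℝ) =>
      (S.1.map fun I : ℝ × ℝ => min I.1 ((m : ℝ) * I.2) + I.2).sum +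
        (S.2.1.map fun I : ℝ × ℝ => min I.1 ((m : ℝ) * I.2)).sum +
        (S.2.2.map fun I : ℝ × ℝ => I.2).sum).subset ?_).bddAbove
  rintro r ⟨S₁, S₂, S₃, -, -, -, hS, rfl⟩
  refine ⟨(S₁, S₂, S₃), ⟨?_, ?_, ?_⟩, rfl⟩
  · exact ((Multiset.le_add_right _ _).trans (Multiset.le_add_right _ _)).trans hS
  · exact ((Multiset.le_add_left _ _).trans (Multiset.le_add_right _ _)).trans hS
  · exact (Multiset.le_add_left _ _).trans hS

theorem efunValues_nonempty (m k l p : ℕ) (B : Multiset (ℝ × ℝ)) :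
    (efunValues m k l p B).Nonempty := by
  refine ⟨_, Multiset.replicate p (0, 0), Multiset.replicate k (0, 0), Multiset.replicate l (0, 0),
    by simp, by simp, by simp, ?_, rfl⟩
  rw [← Multiset.replicate_add, ← Multiset.replicate_add]
  exact Multiset.le_add_left _ _

theorem Efun_le_add_of_rel {m k l p : ℕ} {ε : ℝ} (hε : 0 ≤ ε) {B₁ B₂ : Multiset (ℝ × ℝ)} {a b : ℕ}
    (ha : p + k + l ≤ a)
    (h : Multiset.Rel (IntervalsClose m ε) (B₁ + Multiset.replicate a (0, 0))
      (B₂ + Multiset.replicate b (0, 0))) :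
    Efun m k l p B₁ ≤ Efun m k l p B₂ + (p + k + l) * (2 * m + 2) * ε := by
  refine csSup_le (efunValues_nonempty m k l p B₁) ?_
  rintro r ⟨S₁, S₂, S₃, h₁, h₂, h₃, hS, rfl⟩
  have hS' := hS.trans
    (add_le_add_right (Multiset.replicate_le_replicate ((0 : ℝ), (0 : ℝ)) |>.2 ha) B₁)
  obtain ⟨U, hU⟩ := Multiset.le_iff_exists_add.1 hS'
  rw [hU] at h
  obtain ⟨T, V, hT, -, hTV⟩ := Multiset.rel_add_left.1 h
  obtain ⟨T', T₃, hT', hT₃, rfl⟩ := Multiset.rel_add_left.1 hT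
  obtain ⟨T₁, T₂, hT₁, hT₂, rfl⟩ := Multiset.rel_add_left.1 hT'
  have c₁ := Multiset.card_eq_card_of_rel hT₁
  have c₂ := Multiset.card_eq_card_of_rel hT₂
  have c₃ := Multiset.card_eq_card_of_rel hT₃
  have hle : T₁ + T₂ + T₃ ≤ B₂ + Multiset.replicate b ((0 : ℝ), (0 : ℝ)) :=
    hTV ▸ Multiset.le_add_right _ _
  have hle' := Multiset.le_add_replicate_card hle
  rw [Multiset.card_add, Multiset.card_add, ← c₁, ← c₂, ← c₃, h₁, h₂, h₃] at hle'
  have hsup := le_csSup (efunValues_bddAbove m k l p B₂)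
    ⟨T₁, T₂, T₃, c₁ ▸ h₁, c₂ ▸ h₂, c₃ ▸ h₃, hle', rfl⟩
  have hmε : 0 ≤ (m : ℝ) * ε := by positivity
  have e₁ := hT₁.abs_sum_map_sub_le (f := fun I : ℝ × ℝ => min I.1 ((m : ℝ) * I.2) + I.2)
    (g := fun I : ℝ × ℝ => min I.1 ((m : ℝ) * I.2) + I.2) (c := (2 * m + 2) * ε) (by
      rintro I J ⟨hI, hJ⟩
      rw [abs_le] at *
      constructor <;> linarith)
  have e₂ := hT₂.abs_sum_map_sub_le (f := fun I : ℝ × ℝ => min I.1 ((m : ℝ) * I.2))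
    (g := fun I : ℝ × ℝ => min I.1 ((m : ℝ) * I.2)) (c := (2 * m + 2) * ε) (by
      rintro I J ⟨hI, -⟩
      linarith)
  have e₃ := hT₃.abs_sum_map_sub_le (f := fun I : ℝ × ℝ => I.2)
    (g := fun I : ℝ × ℝ => I.2) (c := (2 * m + 2) * ε) (by
      rintro I J ⟨-, hJ⟩
      linarith)
  rw [h₁] at e₁
  rw [h₂] at e₂
  rw [h₃] at e₃
  have e₁' := (abs_le.1 e₁).2
  have e₂' := (abs_le.1 e₂).2
  have e₃' := (abs_le.1 e₃).2
  change _ ≤ Efun m k l p B₂ at hsup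
  linarith

theorem exists_rel_intervalsClose {m : ℕ} (hm : 1 ≤ m) (n : ℕ) {ε : ℝ} (hε : 0 ≤ ε)
    (B₁ B₂ : Barcode) {M : Multiset ((ℝ × ℝ) × (ℝ × ℝ))} (hM : IsMatching B₁.1 B₂.1 M)
    (hmatched : ∀ IJ ∈ M, intervalDist IJ.1 IJ.2 ≤ ε)
    (hunmatched : ∀ I ∈ (B₁.1 - M.map Prod.fst) + (B₂.1 - M.map Prod.snd), I.2 / 2 ≤ ε) :
    ∃ a b : ℕ, n ≤ a ∧ n ≤ b ∧
      Multiset.Rel (IntervalsClose m ε) (B₁.1 + Multiset.replicate a (0, 0))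
        (B₂.1 + Multiset.replicate b (0, 0)) := by
  obtain ⟨hM₁, hM₂⟩ := hM
  set U₁ := B₁.1 - M.map Prod.fst
  set U₂ := B₂.1 - M.map Prod.snd
  have e₁ : B₁.1 = M.map Prod.fst + U₁ := (add_tsub_cancel_of_le hM₁).symm
  have e₂ : B₂.1 = M.map Prod.snd + U₂ := (add_tsub_cancel_of_le hM₂).symm
  have r₀ : Multiset.Rel (IntervalsClose m ε) (M.map Prod.fst) (M.map Prod.snd) := by
    rw [Multiset.rel_map]
    exact Multiset.rel_refl_of_refl_on fun IJ hIJ =>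
      IntervalsClose.of_intervalDist_le hm (hmatched IJ hIJ)
  have r₁ : Multiset.Rel (IntervalsClose m ε) U₁ (Multiset.replicate U₁.card (0, 0)) := by
    refine Multiset.rel_replicate_right.2 ⟨rfl, fun I hI => ?_⟩
    have hB := B₁.2 I (e₁ ▸ Multiset.mem_add.2 (Or.inr hI))
    exact IntervalsClose.zero_right hB.1 hB.2 (hunmatched I (Multiset.mem_add.2 (Or.inl hI)))
  have r₂ : Multiset.Rel (IntervalsClose m ε) (Multiset.replicate U₂.card (0, 0)) U₂ := by
    refine Multiset.rel_replicate_left.2 ⟨rfl, fun I hI => ?_⟩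
    have hB := B₂.2 I (e₂ ▸ Multiset.mem_add.2 (Or.inr hI))
    exact (IntervalsClose.zero_right hB.1 hB.2
      (hunmatched I (Multiset.mem_add.2 (Or.inr hI)))).symm
  have r₃ : Multiset.Rel (IntervalsClose m ε) (Multiset.replicate n (0, 0))
      (Multiset.replicate n (0, 0)) :=
    Multiset.rel_refl_of_refl_on fun I hI => by
      rw [Multiset.eq_of_mem_replicate hI]
      exact IntervalsClose.zero_right le_rfl le_rfl (by simpa using hε)
  refine ⟨U₂.card + n, U₁.card + n, Nat.le_add_left _ _, Nat.le_add_left _ _, ?_⟩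
  have r := ((r₀.add r₁).add r₂).add r₃
  rw [← e₁] at r
  convert r using 1
  · rw [Multiset.replicate_add, add_assoc]
  · rw [Multiset.replicate_add, e₂]
    abel

theorem intervalDist_nonneg (I J : ℝ × ℝ) : 0 ≤ intervalDist I J :=
  le_max_of_le_left (abs_nonneg _)

/-- A matching of Wasserstein penalty `P` moves every interval by at most `P ^ (1 / q)`. -/
theorem penaltyP_bounds {q : ℝ} (hq : 1 ≤ q) (B₁ B₂ : Barcode)
    (M : Multiset ((ℝ × ℝ) × (ℝ × ℝ))) :
    0 ≤ penaltyP q B₁.1 B₂.1 M ∧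
    (∀ IJ ∈ M, intervalDist IJ.1 IJ.2 ≤ penaltyP q B₁.1 B₂.1 M ^ (1 / q)) ∧
    ∀ I ∈ (B₁.1 - M.map Prod.fst) + (B₂.1 - M.map Prod.snd),
      I.2 / 2 ≤ penaltyP q B₁.1 B₂.1 M ^ (1 / q) := by
  have hq0 : 0 < q := by linarith
  have hd : ∀ I ∈ (B₁.1 - M.map Prod.fst) + (B₂.1 - M.map Prod.snd), 0 ≤ I.2 / 2 := by
    intro I hI
    rcases Multiset.mem_add.1 hI with hI | hI
    · linarith [(B₁.2 I (Multiset.mem_of_le tsub_le_self hI)).2]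
    · linarith [(B₂.2 I (Multiset.mem_of_le tsub_le_self hI)).2]
  have n₁ : ∀ x ∈ M.map fun IJ : (ℝ × ℝ) × (ℝ × ℝ) => intervalDist IJ.1 IJ.2 ^ q, 0 ≤ x := by
    intro x hx
    obtain ⟨IJ, -, rfl⟩ := Multiset.mem_map.1 hx
    exact Real.rpow_nonneg (intervalDist_nonneg _ _) q
  have n₂ : ∀ x ∈ ((B₁.1 - M.map Prod.fst) + (B₂.1 - M.map Prod.snd)).map
      fun I : ℝ × ℝ => (I.2 / 2) ^ q, 0 ≤ x := by
    intro x hx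
    obtain ⟨I, hI, rfl⟩ := Multiset.mem_map.1 hx
    exact Real.rpow_nonneg (hd I hI) q
  have s₁ := Multiset.sum_nonneg n₁
  have s₂ := Multiset.sum_nonneg n₂
  have hP : 0 ≤ penaltyP q B₁.1 B₂.1 M := add_nonneg s₁ s₂
  refine ⟨hP, fun IJ hIJ => ?_, fun I hI => ?_⟩
  · rw [one_div, Real.le_rpow_inv_iff_of_pos (intervalDist_nonneg _ _) hP hq0]
    exact (Multiset.single_le_sum n₁ _ (Multiset.mem_map_of_mem _ hIJ)).trans
      (le_add_of_nonneg_right s₂)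
  · rw [one_div, Real.le_rpow_inv_iff_of_pos (hd I hI) hP hq0]
    exact (Multiset.single_le_sum n₂ _
      (Multiset.mem_map_of_mem (fun I : ℝ × ℝ => (I.2 / 2) ^ q) hI)).trans
      (le_add_of_nonneg_left s₁)

theorem wassersteinDist_nonneg {q : ℝ} (hq : 1 ≤ q) (B₁ B₂ : Barcode) :
    0 ≤ wassersteinDist q B₁.1 B₂.1 := by
  refine Real.rpow_nonneg (Real.sInf_nonneg ?_) _
  rintro r ⟨M, -, rfl⟩
  exact (penaltyP_bounds hq B₁ B₂ M).1

theorem le_wassersteinDist {q : ℝ} (hq : 1 ≤ q) (B₁ B₂ : Barcode) {c : ℝ} (hc : 0 ≤ c)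
    (h : ∀ M, IsMatching B₁.1 B₂.1 M → c ≤ penaltyP q B₁.1 B₂.1 M ^ (1 / q)) :
    c ≤ wassersteinDist q B₁.1 B₂.1 := by
  have hq0 : 0 < q := by linarith
  have hcq : c ^ q ≤ sInf { r | ∃ M, IsMatching B₁.1 B₂.1 M ∧ r = penaltyP q B₁.1 B₂.1 M } := by
    refine le_csInf ⟨_, 0, by simp [IsMatching], rfl⟩ ?_
    rintro r ⟨M, hM, rfl⟩
    rw [← Real.le_rpow_inv_iff_of_pos hc (penaltyP_bounds hq B₁ B₂ M).1 hq0, ← one_div]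
    exact h M hM
  rw [wassersteinDist, one_div, Real.le_rpow_inv_iff_of_pos hc _ hq0]
  · exact hcq
  · exact (Real.rpow_nonneg hc q).trans hcq

theorem abs_Efun_sub_le {m k l p : ℕ} (hm : 1 ≤ m) (hklp : 1 ≤ k + l + p) {q : ℝ} (hq : 1 ≤ q)
    (B₁ B₂ : Barcode) :
    |Efun m k l p B₁.1 - Efun m k l p B₂.1| ≤
      (p + k + l) * (2 * m + 2) * wassersteinDist q B₁.1 B₂.1 := by
  have hn : (0 : ℝ) < p + k + l := by
    have : (1 : ℝ) ≤ k + l + p := by exact_mod_cast hklp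
    linarith
  have hC : (0 : ℝ) < (p + k + l) * (2 * m + 2) := by positivity
  rw [← div_le_iff₀' hC]
  refine le_wassersteinDist hq B₁ B₂ (by positivity) fun M hM => ?_
  rw [div_le_iff₀' hC]
  obtain ⟨hP, h₁, h₂⟩ := penaltyP_bounds hq B₁ B₂ M
  have hε := Real.rpow_nonneg hP (1 / q)
  obtain ⟨a, b, ha, hb, hr⟩ := exists_rel_intervalsClose hm (p + k + l) hε B₁ B₂ hM h₁ h₂
  have hr' : Multiset.Rel (IntervalsClose m (penaltyP q B₁.1 B₂.1 M ^ (1 / q)))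
      (B₂.1 + Multiset.replicate b (0, 0)) (B₁.1 + Multiset.replicate a (0, 0)) :=
    (Multiset.rel_flip.2 hr).mono fun _ _ _ _ h => IntervalsClose.symm h
  have l₁ := Efun_le_add_of_rel (k := k) (l := l) (p := p) hε ha hr
  have l₂ := Efun_le_add_of_rel (k := k) (l := l) (p := p) hε hb hr'
  rw [abs_le]
  constructor <;> linarith

/-- Wasserstein stability of the semiring generated by the tropical rational
coordinates. -/
theorem tropical_coordinates_wasserstein_stability (F : Barcode → ℝ) (hF : MemG F)
    (q : ℝ) (hq : 1 ≤ q) :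
    ∃ C : ℝ, 0 ≤ C ∧ ∀ B₁ B₂ : Barcode,
      |F B₁ - F B₂| ≤ C * wassersteinDist q B₁.1 B₂.1 := by
  induction hF with
  | const c => exact ⟨0, le_rfl, by simp⟩
  | coord m k l p hm hklp =>
    exact ⟨(p + k + l) * (2 * m + 2), by positivity, abs_Efun_sub_le hm hklp hq⟩
  | @add f g _ _ ihf ihg =>
    obtain ⟨C, hC, hf⟩ := ihf
    obtain ⟨D, hD, hg⟩ := ihg
    refine ⟨C + D, add_nonneg hC hD, fun B₁ B₂ => ?_⟩
    rw [add_sub_add_comm, add_mul]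
    exact (abs_add_le _ _).trans (add_le_add (hf B₁ B₂) (hg B₁ B₂))
  | @max f g _ _ ihf ihg =>
    obtain ⟨C, hC, hf⟩ := ihf
    obtain ⟨D, hD, hg⟩ := ihg
    refine ⟨Max.max C D, le_max_of_le_left hC, fun B₁ B₂ => ?_⟩
    rw [max_mul_of_nonneg _ _ (wassersteinDist_nonneg hq B₁ B₂)]
    exact (abs_max_sub_max_le_max _ _ _ _).trans (max_le_max (hf B₁ B₂) (hg B₁ B₂))
  | @min f g _ _ ihf ihg =>
    obtain ⟨C, hC, hf⟩ := ihf
    obtain ⟨D, hD, hg⟩ := ihg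
    refine ⟨Max.max C D, le_max_of_le_left hC, fun B₁ B₂ => ?_⟩
    rw [max_mul_of_nonneg _ _ (wassersteinDist_nonneg hq B₁ B₂)]
    exact (abs_min_sub_min_le_max _ _ _ _).trans (max_le_max (hf B₁ B₂) (hg B₁ B₂))
end
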